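/- Let d ≥ 2 and let A, B, C be disjoint nonempty finite index sets. Let ψ : ([d]^A × [d]^B × [d]^C) → ℝ satisfy ψ ≥ 0 and ∑_x ψ(x)² = 1 (a sign-free state), and let p(x) := ψ(x)² be its measurement distribution, with I(A:C|B) its conditional mutual information in nats under the tripartition. Let ρ_A be the Hermitian positive semidefinite matrix indexed by [d]^A with entries ρ_A(x_A, x'_A) = ∑_{y ∈ [d]^B × [d]^C} ψ(x_A, y)·ψ(x'_A, y) (the reduced density matrix on A). Suppose I(A:C|B) ≤ 2, and set δ := 2·√( 1 − (1 − √(I(A:C|B)/2))² ). If δ ≤ 1/e, then the von Neumann entropy of the reduced state satisfies S(ρ_A) ≤ |B|·ln d + δ·( |A|·ln d + ln(1/δ) ). -/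

import Mathlib

open Classical

/-- Conditional mutual information (in nats) I(A:C|B) of the distribution
induced by `p : Γ → ℝ` under the projections `fA, fB, fC`. -/
noncomputable def condMI {Γ α β γ : Type*} [Fintype Γ] [Fintype α] [Fintype β] [Fintype γ]
    (p : Γ → ℝ) (fA : Γ → α) (fB : Γ → β) (fC : Γ → γ) : ℝ :=
  ∑ a : α, ∑ b : β, ∑ c : γ,
    let pabc := ∑ g, if fA g = a ∧ fB g = b ∧ fC g = c then p g else 0
    let pb := ∑ g, if fB g = b then p g else 0
    let pab := ∑ g, if fA g = a ∧ fB g = b then p g else 0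
    let pbc := ∑ g, if fB g = b ∧ fC g = c then p g else 0
    if 0 < pabc then pabc * Real.log (pabc * pb / (pab * pbc)) else 0

/-- Von Neumann entropy (natural log) of a matrix, via the eigenvalues of a
Hermitian matrix; junk value 0 for non-Hermitian matrices. -/
noncomputable def vnEntropy {n : Type*} [Fintype n] [DecidableEq n] (ρ : Matrix n n ℂ) : ℝ :=
  if h : ρ.IsHermitian then ∑ i, Real.negMulLog (h.eigenvalues i) else 0

theorem sum_negMulLog_le_of_weights {ι : Type*} [Fintype ι] (l w : ι → ℝ) (r t : ℝ)
    (hl : ∀ i, 0 ≤ l i) (hl1 : ∑ i, l i = 1) (hw0 : ∀ i, 0 ≤ w i) (hw1 : ∀ i, w i ≤ 1)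
    (hr : 0 < r) (hw : ∑ i, w i ≤ r) (ht0 : 0 < t) (ht1 : t < 1) :
    ∑ i, Real.negMulLog (l i) ≤ (∑ i, l i * w i) * (Real.log r - Real.log (1 - t)) +
      (1 - ∑ i, l i * w i) * (Real.log (Fintype.card ι) - Real.log t) := by
  have hne : Nonempty ι := by
    by_contra h
    rw [not_nonempty_iff] at h
    simp at hl1
  have hD : (0 : ℝ) < Fintype.card ι := by exact_mod_cast Fintype.card_pos
  set D : ℝ := (Fintype.card ι : ℝ) with hDdef
  set x := (1 - t) / r with hx
  set y := t / D with hy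
  have hx0 : 0 < x := div_pos (by linarith) hr
  have hy0 : 0 < y := div_pos ht0 hD
  have hlx : Real.log x = Real.log (1 - t) - Real.log r := Real.log_div (by linarith) hr.ne'
  have hly : Real.log y = Real.log t - Real.log D := Real.log_div ht0.ne' hD.ne'
  have gibbs : ∀ i, Real.negMulLog (l i) ≤
      l i * (w i * (-Real.log x) + (1 - w i) * (-Real.log y)) +
        (w i * x + (1 - w i) * y - l i) := by
    intro i
    set q := x ^ w i * y ^ (1 - w i) with hq
    have hq0 : 0 < q := by positivity
    have hqle : q ≤ w i * x + (1 - w i) * y :=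
      Real.geom_mean_le_arith_mean2_weighted (hw0 i) (by linarith [hw1 i]) hx0.le hy0.le (by ring)
    have hlq : Real.log q = w i * Real.log x + (1 - w i) * Real.log y := by
      rw [hq, Real.log_mul (by positivity) (by positivity), Real.log_rpow hx0, Real.log_rpow hy0]
    have key : Real.negMulLog (l i) ≤ l i * (-Real.log q) + (q - l i) := by
      rcases (hl i).eq_or_lt with h | h
      · simp [← h, hq0.le]
      · have := Real.log_le_sub_one_of_pos (div_pos hq0 h)
        rw [Real.log_div hq0.ne' h.ne'] at this
        have h2 := mul_le_mul_of_nonneg_left this h.le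
        have h3 : l i * (q / l i - 1) = q - l i := by field_simp
        rw [Real.negMulLog]
        linarith
    rw [hlq] at key
    linarith
  have hxy : ∑ i, (w i * x + (1 - w i) * y) ≤ 1 := by
    rw [Finset.sum_add_distrib, ← Finset.sum_mul, ← Finset.sum_mul, Finset.sum_sub_distrib]
    simp only [Finset.sum_const, Finset.card_univ, nsmul_eq_mul, mul_one, ← hDdef]
    have h1 : (∑ i, w i) * x ≤ 1 - t := by
      calc _ ≤ r * x := by gcongr
        _ = 1 - t := by rw [hx]; field_simp
    have h2 : (D - ∑ i, w i) * y ≤ t := by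
      calc _ ≤ D * y := by
            gcongr
            linarith [Finset.sum_nonneg fun i (_ : i ∈ Finset.univ) => hw0 i]
        _ = t := by rw [hy]; field_simp
    linarith
  calc _ ≤ _ := Finset.sum_le_sum fun i _ => gibbs i
    _ = (∑ i, l i * w i) * (-Real.log x) + (1 - ∑ i, l i * w i) * (-Real.log y) +
        (∑ i, (w i * x + (1 - w i) * y) - 1) := by
      rw [Finset.sum_add_distrib, Finset.sum_sub_distrib, hl1]
      congr 1
      have h1W : 1 - ∑ i, l i * w i = ∑ i, (l i - l i * w i) := by
        rw [Finset.sum_sub_distrib, hl1]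
      rw [h1W, Finset.sum_mul, Finset.sum_mul, ← Finset.sum_add_distrib]
      exact Finset.sum_congr rfl fun i _ => by ring
    _ ≤ _ := by rw [hlx, hly]; linarith

theorem sum_negMulLog_le_of_concentrated {ι : Type*} [Fintype ι] (l w : ι → ℝ) (r δ : ℝ)
    (hl : ∀ i, 0 ≤ l i) (hl1 : ∑ i, l i = 1) (hw0 : ∀ i, 0 ≤ w i) (hw1 : ∀ i, w i ≤ 1)
    (hr : 1 ≤ r) (hw : ∑ i, w i ≤ r) (hδ0 : 0 ≤ δ) (hδe : δ ≤ 1 / Real.exp 1)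
    (hW : 1 - δ ^ 2 / 4 ≤ ∑ i, l i * w i) :
    ∑ i, Real.negMulLog (l i) ≤
      Real.log r + δ * (Real.log (Fintype.card ι) + Real.log (1 / δ)) := by
  have hbound := fun t => sum_negMulLog_le_of_weights l w r t hl hl1 hw0 hw1 (by linarith) hw
  have hne : Nonempty ι := by
    by_contra h
    rw [not_nonempty_iff] at h
    simp at hl1
  have hD : (1 : ℝ) ≤ Fintype.card ι := by exact_mod_cast Fintype.card_pos
  have hlD := Real.log_nonneg hD
  have hlr := Real.log_nonneg hr
  have hW1 : ∑ i, l i * w i ≤ 1 := by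
    rw [← hl1]
    exact Finset.sum_le_sum fun i _ => mul_le_of_le_one_right (hl i) (hw1 i)
  set W := ∑ i, l i * w i with hWdef
  clear_value W
  rcases hδ0.eq_or_lt with h0 | hpos
  · subst h0
    have hW' : W = 1 := by norm_num at hW; linarith
    have hlim : Filter.Tendsto (fun t : ℝ => Real.log r - Real.log (1 - t))
        (nhdsWithin 0 (Set.Ioi 0)) (nhds (Real.log r - Real.log (1 - 0))) := by
      have : ContinuousAt (fun t : ℝ => Real.log r - Real.log (1 - t)) 0 := by
        refine continuousAt_const.sub (ContinuousAt.log (by fun_prop) (by norm_num))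
      exact this.tendsto.mono_left nhdsWithin_le_nhds
    have := ge_of_tendsto hlim (b := ∑ i, Real.negMulLog (l i)) (by
      filter_upwards [Ioo_mem_nhdsGT (zero_lt_one' ℝ)] with t ht
      simpa [hW'] using hbound t ht.1 ht.2)
    simpa using this
  · have he : 1 / Real.exp 1 < 0.4 := by
      rw [div_lt_iff₀ (Real.exp_pos 1)]
      linarith [Real.exp_one_gt_d9]
    have hL : 1 ≤ Real.log (1 / δ) := by
      rw [Real.le_log_iff_exp_le (by positivity), le_div_iff₀ hpos]
      rw [le_div_iff₀ (Real.exp_pos 1)] at hδe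
      linarith
    have hlt : Real.log (δ / 4) = - Real.log (1 / δ) - 2 * Real.log 2 := by
      rw [Real.log_div hpos.ne' (by norm_num), one_div, Real.log_inv,
        show (4 : ℝ) = 2 ^ 2 by norm_num, Real.log_pow]
      push_cast
      ring
    have hl1t : - Real.log (1 - δ / 4) ≤ δ / 2 := by
      have := Real.one_sub_inv_le_log_of_pos (show 0 < 1 - δ / 4 by linarith)
      have h2 : (1 - δ / 4)⁻¹ ≤ 1 + δ / 2 := by
        rw [inv_le_iff_one_le_mul₀ (by linarith)]
        nlinarith
      linarith
    have hl1t0 : 0 ≤ - Real.log (1 - δ / 4) := by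
      linarith [Real.log_nonpos (show 0 ≤ 1 - δ / 4 by linarith) (by linarith)]
    have hln2 := Real.log_two_lt_d9
    have hln2' := Real.log_two_gt_d9
    have hWδ : 1 - W ≤ δ / 4 := by nlinarith
    have hb := hbound (δ / 4) (by linarith) (by linarith)
    rw [hlt] at hb
    have h1 : W * (Real.log r - Real.log (1 - δ / 4)) ≤ Real.log r + δ / 2 := by
      calc _ ≤ 1 * (Real.log r - Real.log (1 - δ / 4)) := by
            apply mul_le_mul_of_nonneg_right hW1; linarith
        _ ≤ _ := by linarith
    have h2 : (1 - W) * (Real.log (Fintype.card ι) - (-Real.log (1 / δ) - 2 * Real.log 2)) ≤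
        δ / 4 * (Real.log (Fintype.card ι) + Real.log (1 / δ) + 2 * Real.log (1 / δ) - 1 / 2) := by
      refine mul_le_mul hWδ ?_ ?_ ?_ <;> linarith
    nlinarith

theorem exists_weights_of_span {ι E Y β : Type*} [Fintype ι] [Fintype Y] [Fintype β]
    [NormedAddCommGroup E] [InnerProductSpace ℂ E]
    (u : OrthonormalBasis ι ℂ E) (l : ι → ℝ) (Ψ Φ : Y → E) (f : β → E)
    (hl : ∀ i, (l i : ℂ) • u i = ∑ y, inner ℂ (Ψ y) (u i) • Ψ y)
    (hΦ : ∀ y, Φ y ∈ Submodule.span ℂ (Set.range f)) (hΦ1 : ∑ y, ‖Φ y‖ ^ 2 ≤ 1) :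
    ∃ w : ι → ℝ, (∀ i, 0 ≤ w i) ∧ (∀ i, w i ≤ 1) ∧ ∑ i, w i ≤ Fintype.card β ∧
      ‖∑ y, inner ℂ (Ψ y) (Φ y)‖ ^ 2 ≤ ∑ i, l i * w i := by
  have : FiniteDimensional ℂ E := u.toBasis.finiteDimensional_of_finite
  set S := Submodule.span ℂ (Set.range f) with hS
  let b := stdOrthonormalBasis ℂ S
  let v : Fin (Module.finrank ℂ S) → E := fun j => (b j : E)
  have hv : Orthonormal ℂ v := b.orthonormal.comp_linearIsometry S.subtypeₗᵢ
  refine ⟨fun i => ∑ j, ‖inner ℂ (v j) (u i)‖ ^ 2, fun i => by positivity, fun i => ?_, ?_, ?_⟩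
  · simpa using hv.sum_inner_products_le (u i) (s := Finset.univ)
  · rw [Finset.sum_comm]
    simp only [u.sum_sq_norm_inner_left, hv.1]
    simpa [Set.finrank] using finrank_range_le_card (R := ℂ) f
  · have hquad : ∀ x, ∑ i, l i * ‖inner ℂ x (u i)‖ ^ 2 = ∑ y, ‖inner ℂ (Ψ y) x‖ ^ 2 := by
      intro x
      have hsq : ∀ a c : E, ((‖inner ℂ a c‖ ^ 2 : ℝ) : ℂ) = inner ℂ a c * inner ℂ c a := by
        intro a c
        rw [← inner_conj_symm c a, Complex.mul_conj, Complex.normSq_eq_norm_sq]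
      apply Complex.ofReal_injective
      simp only [Complex.ofReal_sum, Complex.ofReal_mul, hsq]
      calc _ = ∑ i, ∑ y, inner ℂ x (Ψ y) * (inner ℂ (Ψ y) (u i) * inner ℂ (u i) x) := by
            refine Finset.sum_congr rfl fun i _ => ?_
            rw [← mul_assoc, ← inner_smul_right x (u i), hl, inner_sum, Finset.sum_mul]
            refine Finset.sum_congr rfl fun y _ => ?_
            rw [inner_smul_right]
            ring
        _ = _ := by
            rw [Finset.sum_comm]
            refine Finset.sum_congr rfl fun y _ => ?_
            rw [← Finset.mul_sum, u.sum_inner_mul_inner, mul_comm]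
    have hexp : ∀ y, inner ℂ (Ψ y) (Φ y) = ∑ j, inner ℂ (Ψ y) (v j) * inner ℂ (v j) (Φ y) := by
      intro y
      have h := congrArg (Subtype.val) (b.sum_repr' ⟨Φ y, hΦ y⟩)
      conv_lhs => rw [show Φ y = ∑ j, inner ℂ (v j) (Φ y) • v j by simpa using h.symm]
      rw [inner_sum]
      refine Finset.sum_congr rfl fun j _ => ?_
      rw [inner_smul_right, mul_comm]
    have hbessel : ∑ y, ∑ j, ‖inner ℂ (v j) (Φ y)‖ ^ 2 ≤ 1 :=
      (Finset.sum_le_sum fun y _ => by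
        simpa using hv.sum_inner_products_le (Φ y) (s := Finset.univ)).trans hΦ1
    calc ‖∑ y, inner ℂ (Ψ y) (Φ y)‖ ^ 2
        ≤ (∑ z : Y × Fin (Module.finrank ℂ S),
            ‖inner ℂ (Ψ z.1) (v z.2)‖ * ‖inner ℂ (v z.2) (Φ z.1)‖) ^ 2 := by
          gcongr
          simp only [hexp]
          rw [← Fintype.sum_prod_type']
          refine (norm_sum_le _ _).trans_eq ?_
          simp only [norm_mul]
      _ ≤ (∑ z : Y × Fin (Module.finrank ℂ S), ‖inner ℂ (Ψ z.1) (v z.2)‖ ^ 2) *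
            ∑ z : Y × Fin (Module.finrank ℂ S), ‖inner ℂ (v z.2) (Φ z.1)‖ ^ 2 :=
          Finset.sum_mul_sq_le_sq_mul_sq _ _ _
      _ ≤ ∑ z : Y × Fin (Module.finrank ℂ S), ‖inner ℂ (Ψ z.1) (v z.2)‖ ^ 2 := by
          refine mul_le_of_le_one_right (by positivity) ?_
          rwa [Fintype.sum_prod_type]
      _ = ∑ i, l i * ∑ j, ‖inner ℂ (v j) (u i)‖ ^ 2 := by
          simp only [Finset.mul_sum]
          rw [Finset.sum_comm, Fintype.sum_prod_type_right]
          exact Finset.sum_congr rfl fun j _ => (hquad (v j)).symm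

theorem weight_eq_sum_norm_inner_sq {ι E Y : Type*} [Fintype ι] [Fintype Y]
    [NormedAddCommGroup E] [InnerProductSpace ℂ E]
    (u : OrthonormalBasis ι ℂ E) (l : ι → ℝ) (Ψ : Y → E)
    (hl : ∀ i, (l i : ℂ) • u i = ∑ y, inner ℂ (Ψ y) (u i) • Ψ y) (i : ι) :
    l i = ∑ y, ‖inner ℂ (Ψ y) (u i)‖ ^ 2 := by
  have h := congrArg (inner ℂ (u i)) (hl i)
  rw [inner_smul_right, inner_self_eq_norm_sq_to_K, u.orthonormal.1, inner_sum] at h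
  apply Complex.ofReal_injective
  rw [Complex.ofReal_sum]
  simp only [RCLike.ofReal_one, one_pow, mul_one] at h
  rw [h]
  refine Finset.sum_congr rfl fun y _ => ?_
  rw [inner_smul_right, ← inner_conj_symm (u i) (Ψ y), Complex.mul_conj, Complex.normSq_eq_norm_sq]

theorem one_sub_half_condMI_le_sum_sqrt {α β γ : Type*} [Fintype α] [Fintype β] [Fintype γ]
    (p : α × β × γ → ℝ) (hp : ∀ x, 0 ≤ p x) (hp1 : ∑ x, p x = 1) :
    ∃ (f : β → α → ℝ) (g : β → γ → ℝ),
      ∑ y : β × γ, ∑ a, (f y.1 a * g y.1 y.2) ^ 2 ≤ 1 ∧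
      1 - condMI p (fun x => x.1) (fun x => x.2.1) (fun x => x.2.2) / 2 ≤
        ∑ y : β × γ, ∑ a, √(p (a, y.1, y.2)) * (f y.1 a * g y.1 y.2) := by
  set pab : α → β → ℝ := fun a b => ∑ c, p (a, b, c) with hpab
  set pbc : β → γ → ℝ := fun b c => ∑ a, p (a, b, c) with hpbc
  set pb : β → ℝ := fun b => ∑ a, ∑ c, p (a, b, c) with hpb
  have hab0 : ∀ a b, 0 ≤ pab a b := fun a b => Finset.sum_nonneg fun c _ => hp _
  have hbc0 : ∀ b c, 0 ≤ pbc b c := fun b c => Finset.sum_nonneg fun a _ => hp _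
  have hb0 : ∀ b, 0 ≤ pb b := fun b => Finset.sum_nonneg fun a _ => hab0 a b
  have hbc_sum : ∀ b, ∑ c, pbc b c = pb b := fun b => Finset.sum_comm
  have hb_sum : ∑ b, pb b = 1 := by
    rw [← hp1, Fintype.sum_prod_type, Finset.sum_comm]
    exact Finset.sum_congr rfl fun a _ => by rw [Fintype.sum_prod_type]
  have hcond : condMI p (fun x => x.1) (fun x => x.2.1) (fun x => x.2.2) =
      ∑ a, ∑ b, ∑ c, if 0 < p (a, b, c) then
        p (a, b, c) * Real.log (p (a, b, c) * pb b / (pab a b * pbc b c)) else 0 := by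
    unfold condMI
    refine Finset.sum_congr rfl fun a _ => Finset.sum_congr rfl fun b _ =>
      Finset.sum_congr rfl fun c _ => ?_
    have hdelta : ∀ F : β → γ → ℝ,
        (∑ b', ∑ c', if b' = b then F b' c' else 0) = ∑ c', F b c' := by
      intro F
      rw [Finset.sum_comm]
      simp
    simp [Fintype.sum_prod_type, ite_and, hpb, hpab, hpbc, hdelta]
  have hterm : ∀ a b c, 2 * (p (a, b, c) -
      √(p (a, b, c)) * (√(pab a b) * √(pbc b c / pb b))) ≤
      if 0 < p (a, b, c) then
        p (a, b, c) * Real.log (p (a, b, c) * pb b / (pab a b * pbc b c)) else 0 := by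
    intro a b c
    split_ifs with h
    · have hab : 0 < pab a b :=
        h.trans_le (Finset.single_le_sum (f := fun c => p (a, b, c)) (fun c _ => hp _)
          (Finset.mem_univ c))
      have hbc : 0 < pbc b c :=
        h.trans_le (Finset.single_le_sum (f := fun a => p (a, b, c)) (fun c _ => hp _)
          (Finset.mem_univ a))
      have hb : 0 < pb b :=
        hab.trans_le (Finset.single_le_sum (f := fun a => pab a b) (fun a _ => hab0 a b)
          (Finset.mem_univ a))
      rw [← Real.sqrt_mul hab.le]
      set q := pab a b * (pbc b c / pb b) with hq
      have hq0 : 0 < q := by positivity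
      have hratio : p (a, b, c) * pb b / (pab a b * pbc b c) = p (a, b, c) / q := by
        rw [hq]
        field_simp
      set x := √(p (a, b, c)) with hx
      have hx0 : 0 < x := Real.sqrt_pos.2 h
      have hxp : p (a, b, c) = x ^ 2 := (Real.sq_sqrt h.le).symm
      have hs0 : 0 < √q := Real.sqrt_pos.2 hq0
      have hlog := Real.log_le_sub_one_of_pos (div_pos hs0 hx0)
      rw [Real.log_div hs0.ne' hx0.ne', Real.log_sqrt hq0.le] at hlog
      rw [hratio, Real.log_div h.ne' hq0.ne', hxp, Real.log_pow]
      have h2 := mul_le_mul_of_nonneg_left hlog (sq_nonneg x)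
      have h3 : x ^ 2 * (√q / x - 1) = x * √q - x ^ 2 := by field_simp
      push_cast
      linarith
    · have h0 : p (a, b, c) = 0 := le_antisymm (not_lt.1 h) (hp _)
      simp [h0]
  refine ⟨fun b a => √(pab a b), fun b c => √(pbc b c / pb b), ?_, ?_⟩
  · calc _ = ∑ b, ∑ c, pb b * (pbc b c / pb b) := by
          rw [Fintype.sum_prod_type]
          refine Finset.sum_congr rfl fun b _ => Finset.sum_congr rfl fun c _ => ?_
          rw [hpb, Finset.sum_mul]
          refine Finset.sum_congr rfl fun a _ => ?_
          rw [mul_pow, Real.sq_sqrt (hab0 a b), Real.sq_sqrt (div_nonneg (hbc0 b c) (hb0 b))]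
      _ ≤ ∑ b, pb b := by
          refine Finset.sum_le_sum fun b _ => ?_
          rw [← Finset.mul_sum, ← Finset.sum_div, hbc_sum]
          rcases (hb0 b).eq_or_lt with h | h
          · simp [← h]
          · rw [div_self h.ne', mul_one]
      _ = 1 := hb_sum
  · have hsum := Finset.sum_le_sum fun a (_ : a ∈ Finset.univ) =>
      Finset.sum_le_sum fun b (_ : b ∈ Finset.univ) =>
        Finset.sum_le_sum fun c (_ : c ∈ Finset.univ) => hterm a b c
    rw [← hcond] at hsum
    simp only [← Finset.mul_sum, Finset.sum_sub_distrib] at hsum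
    simp only [Fintype.sum_prod_type] at hp1
    rw [Finset.sum_comm]
    simp only [Fintype.sum_prod_type]
    linarith

theorem eigenvalue_smul_eigenvectorBasis_eq_sum {n Y : Type*} [Fintype n] [DecidableEq n]
    [Fintype Y] {ρ : Matrix n n ℂ} (h : ρ.IsHermitian) (ψ : n → Y → ℝ)
    (hρ : ∀ i j, ρ i j = ((∑ y, ψ i y * ψ j y : ℝ) : ℂ)) (i : n) :
    (h.eigenvalues i : ℂ) • h.eigenvectorBasis i =
      ∑ y, inner ℂ (WithLp.toLp 2 fun a => (ψ a y : ℂ)) (h.eigenvectorBasis i) •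
        (WithLp.toLp 2 fun a => (ψ a y : ℂ) : EuclideanSpace ℂ n) := by
  ext a
  have := congrFun (h.mulVec_eigenvectorBasis i) a
  simp only [Matrix.mulVec, dotProduct, hρ, Pi.smul_apply] at this
  simp only [PiLp.smul_apply, WithLp.ofLp_sum, Finset.sum_apply, WithLp.ofLp_smul, Pi.smul_apply,
    PiLp.inner_apply, smul_eq_mul]
  rw [Complex.real_smul] at this
  rw [← this]
  push_cast
  simp only [Finset.sum_mul]
  rw [Finset.sum_comm]
  refine Finset.sum_congr rfl fun y _ => Finset.sum_congr rfl fun b _ => ?_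
  simp
  ring

/-- Approximate conditional independence of a sign-free state implies an
entanglement entropy bound (area law): S(ρ_A) ≤ |B|·ln d + δ·(|A|·ln d + ln(1/δ)). -/
theorem signfree_cmi_implies_area_law
    (d : ℕ) (hd : 2 ≤ d)
    (A B C : Type) [Fintype A] [Fintype B] [Fintype C]
    [Nonempty A] [Nonempty B] [Nonempty C]
    [DecidableEq A] [DecidableEq B] [DecidableEq C]
    (ψ : (A → Fin d) × (B → Fin d) × (C → Fin d) → ℝ)
    (hψ0 : ∀ x, 0 ≤ ψ x) (hψ1 : ∑ x, ψ x ^ 2 = 1)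
    (I : ℝ)
    (hI : I = condMI (fun x => ψ x ^ 2) (fun x => x.1) (fun x => x.2.1) (fun x => x.2.2))
    (hI2 : I ≤ 2)
    (δ : ℝ) (hδ : δ = 2 * Real.sqrt (1 - (1 - Real.sqrt (I / 2)) ^ 2))
    (hδe : δ ≤ 1 / Real.exp 1)
    (ρA : Matrix (A → Fin d) (A → Fin d) ℂ)
    (hρA : ∀ xA x'A : A → Fin d, ρA xA x'A =
      ((∑ y : (B → Fin d) × (C → Fin d), ψ (xA, y.1, y.2) * ψ (x'A, y.1, y.2) : ℝ) : ℂ)) :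
    vnEntropy ρA ≤ (Fintype.card B : ℝ) * Real.log d +
      δ * ((Fintype.card A : ℝ) * Real.log d + Real.log (1 / δ)) := by
  have hp1 : ∑ x, (fun x => ψ x ^ 2) x = 1 := hψ1
  obtain ⟨f, g, hfg, hF⟩ := one_sub_half_condMI_le_sum_sqrt (fun x => ψ x ^ 2)
    (fun x => sq_nonneg _) hp1
  rw [← hI] at hF
  simp only [Real.sqrt_sq (hψ0 _)] at hF
  have hHerm : ρA.IsHermitian := by
    ext i j
    simp [hρA, mul_comm]
  set ψ' : (A → Fin d) → (B → Fin d) × (C → Fin d) → ℝ := fun a y => ψ (a, y.1, y.2) with hψ'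
  set Ψ : (B → Fin d) × (C → Fin d) → EuclideanSpace ℂ (A → Fin d) :=
    fun y => WithLp.toLp 2 fun a => (ψ' a y : ℂ) with hΨ
  set Φ : (B → Fin d) × (C → Fin d) → EuclideanSpace ℂ (A → Fin d) :=
    fun y => WithLp.toLp 2 fun a => ((f y.1 a * g y.1 y.2 : ℝ) : ℂ) with hΦ
  have heig := eigenvalue_smul_eigenvectorBasis_eq_sum hHerm ψ' hρA
  have hval := weight_eq_sum_norm_inner_sq hHerm.eigenvectorBasis hHerm.eigenvalues Ψ heig
  have hl0 : ∀ i, 0 ≤ hHerm.eigenvalues i := fun i => by rw [hval]; positivity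
  have hl1 : ∑ i, hHerm.eigenvalues i = 1 := by
    simp only [hval]
    rw [Finset.sum_comm]
    simp only [OrthonormalBasis.sum_sq_norm_inner_left, EuclideanSpace.norm_sq_eq, hΨ]
    rw [← hψ1, Finset.sum_comm, Fintype.sum_prod_type]
    simp [hψ']
  obtain ⟨w, hw0, hw1, hwr, hwF⟩ := exists_weights_of_span hHerm.eigenvectorBasis
    hHerm.eigenvalues Ψ Φ
    (fun b => (WithLp.toLp 2 fun a => (f b a : ℂ) : EuclideanSpace ℂ (A → Fin d))) heig
    (fun y => by
      have : Φ y = (g y.1 y.2 : ℂ) • WithLp.toLp 2 fun a => (f y.1 a : ℂ) := by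
        ext a
        simp [hΦ, mul_comm]
      rw [this]
      exact Submodule.smul_mem _ _ (Submodule.subset_span ⟨y.1, rfl⟩))
    (by simpa [EuclideanSpace.norm_sq_eq, hΦ, mul_pow] using hfg)
  have hinner : ∑ y, inner ℂ (Ψ y) (Φ y) =
      ((∑ y : (B → Fin d) × (C → Fin d), ∑ a, ψ (a, y.1, y.2) * (f y.1 a * g y.1 y.2) : ℝ) : ℂ) := by
    push_cast
    refine Finset.sum_congr rfl fun y _ => ?_
    simp only [PiLp.inner_apply]
    refine Finset.sum_congr rfl fun a _ => ?_
    simp [hΨ, hΦ, hψ']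
    ring
  rw [hinner, Complex.norm_real, Real.norm_eq_abs, sq_abs] at hwF
  have hs1 : √(I / 2) ≤ 1 := Real.sqrt_le_one.2 (by linarith)
  have hs0 := Real.sqrt_nonneg (I / 2)
  have hIs : I / 2 ≤ √(I / 2) := by
    rcases le_total (I / 2) 0 with h | h
    · exact h.trans hs0
    · nlinarith [Real.sq_sqrt h]
  have hδ0 : 0 ≤ δ := by rw [hδ]; positivity
  have hδsq : δ ^ 2 / 4 = 1 - (1 - √(I / 2)) ^ 2 := by
    rw [hδ, mul_pow, Real.sq_sqrt (by nlinarith)]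
    ring
  have hd1 : (1 : ℝ) ≤ d := by exact_mod_cast (by omega : 1 ≤ d)
  have hcard : ∀ (X : Type) [Fintype X] [DecidableEq X],
      (Fintype.card (X → Fin d) : ℝ) = (d : ℝ) ^ Fintype.card X := by
    intro X _ _
    simp
  have hmain := sum_negMulLog_le_of_concentrated hHerm.eigenvalues w
    (Fintype.card (B → Fin d)) δ hl0 hl1 hw0 hw1 (by rw [hcard]; exact one_le_pow₀ hd1) hwr
    hδ0 hδe (by
      refine le_trans ?_ hwF
      rw [hδsq, sub_sub_cancel]
      gcongr
      linarith)
  rw [hcard, hcard, Real.log_pow, Real.log_pow] at hmain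
  rwa [vnEntropy, dif_pos hHerm]
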